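/- Let L>0, M>0 and T>L/M. Assume hypothesis (H): for every δ>0 there exist constants C_δ>0 and T_δ>0 such that for every S∈(0,T_δ) and every Dirichlet heat solution φ on [0,∞) (with all integrals below finite): ∫_0^∞∫_0^L e^{-L²/(2t)} φ(t,x)² dx dt ≤ C_δ e^{δ/S} ∫_0^S (∂_xφ(t,0))² dt. Then there exist constants C>0 and K>0 (independent of ε) such that for every ε∈(0,1) and every adjoint transport-diffusion solution ψ (with all integrals finite): ∫_0^L ψ(T,x)² dx ≤ C·e^{-2K/ε}·∫_0^T (∂_xψ(t,0))² dt. -/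

import Mathlib

open MeasureTheory

/-- A "Dirichlet heat solution on `[0,∞)`" for the interval `[0,L]`:
`φ : [0,∞) × [0,L] → ℝ` continuous, `C¹` in `t` and `C²` in `x` on `(0,∞) × [0,L]`,
satisfying `∂_t φ = ∂_{xx} φ` for `t > 0`, `x ∈ (0,L)`, with homogeneous Dirichlet
boundary conditions.  The derivatives are given by the data `φt`, `φx`, `φxx`. -/
structure IsDirichletHeatSol (L : ℝ) (φ φt φx φxx : ℝ → ℝ → ℝ) : Prop where
  cont : ContinuousOn (fun p : ℝ × ℝ => φ p.1 p.2) (Set.Ici 0 ×ˢ Set.Icc 0 L)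
  ht : ∀ t > (0 : ℝ), ∀ x ∈ Set.Icc (0 : ℝ) L,
    HasDerivAt (fun τ => φ τ x) (φt t x) t
  htc : ∀ x ∈ Set.Icc (0 : ℝ) L, ContinuousOn (fun t => φt t x) (Set.Ioi 0)
  hx : ∀ t > (0 : ℝ), ∀ x ∈ Set.Icc (0 : ℝ) L,
    HasDerivWithinAt (fun ξ => φ t ξ) (φx t x) (Set.Icc 0 L) x
  hxc : ∀ t > (0 : ℝ), ContinuousOn (fun x => φx t x) (Set.Icc 0 L)
  hxx : ∀ t > (0 : ℝ), ∀ x ∈ Set.Icc (0 : ℝ) L,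
    HasDerivWithinAt (fun ξ => φx t ξ) (φxx t x) (Set.Icc 0 L) x
  hxxc : ∀ t > (0 : ℝ), ContinuousOn (fun x => φxx t x) (Set.Icc 0 L)
  pde : ∀ t > (0 : ℝ), ∀ x ∈ Set.Ioo (0 : ℝ) L, φt t x = φxx t x
  bc0 : ∀ t ≥ (0 : ℝ), φ t 0 = 0
  bcL : ∀ t ≥ (0 : ℝ), φ t L = 0

/-- An "adjoint transport-diffusion solution" for parameters `L, M, ε`:
`ψ : [0,∞) × [0,L] → ℝ` continuous, `C¹` in `t` and `C²` in `x` on `(0,∞) × [0,L]`,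
with `∂_t ψ - ε ∂_{xx} ψ - M ∂_x ψ = 0` for `t > 0`, `x ∈ (0,L)`, and
`ψ(t,0) = ψ(t,L) = 0` for all `t ≥ 0`.  The derivatives are the data `ψt`, `ψx`, `ψxx`. -/
structure IsAdjointTDSol (L M ε : ℝ) (ψ ψt ψx ψxx : ℝ → ℝ → ℝ) : Prop where
  cont : ContinuousOn (fun p : ℝ × ℝ => ψ p.1 p.2) (Set.Ici 0 ×ˢ Set.Icc 0 L)
  ht : ∀ t > (0 : ℝ), ∀ x ∈ Set.Icc (0 : ℝ) L,
    HasDerivAt (fun τ => ψ τ x) (ψt t x) t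
  htc : ∀ x ∈ Set.Icc (0 : ℝ) L, ContinuousOn (fun t => ψt t x) (Set.Ioi 0)
  hx : ∀ t > (0 : ℝ), ∀ x ∈ Set.Icc (0 : ℝ) L,
    HasDerivWithinAt (fun ξ => ψ t ξ) (ψx t x) (Set.Icc 0 L) x
  hxc : ∀ t > (0 : ℝ), ContinuousOn (fun x => ψx t x) (Set.Icc 0 L)
  hxx : ∀ t > (0 : ℝ), ∀ x ∈ Set.Icc (0 : ℝ) L,
    HasDerivWithinAt (fun ξ => ψx t ξ) (ψxx t x) (Set.Icc 0 L) x
  hxxc : ∀ t > (0 : ℝ), ContinuousOn (fun x => ψxx t x) (Set.Icc 0 L)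
  pde : ∀ t > (0 : ℝ), ∀ x ∈ Set.Ioo (0 : ℝ) L,
    ψt t x - ε * ψxx t x - M * ψx t x = 0
  bc0 : ∀ t ≥ (0 : ℝ), ψ t 0 = 0
  bcL : ∀ t ≥ (0 : ℝ), ψ t L = 0

open scoped Topology

theorem nonpos_of_isLocalMax_of_hasDerivAt {f f' : ℝ → ℝ} {d y : ℝ}
    (hf : ∀ᶠ x in 𝓝 y, HasDerivAt f (f' x) x) (hf' : HasDerivAt f' d y)
    (hmax : IsLocalMax f y) : d ≤ 0 := by
  by_contra! hd
  have hderiv : deriv f =ᶠ[𝓝 y] f' := hf.mono fun x hx => hx.deriv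
  have hmin : IsLocalMin f y := by
    refine isLocalMin_of_deriv_deriv_pos ?_ hmax.deriv_eq_zero hf.self_of_nhds.continuousAt
    rw [hderiv.deriv_eq, hf'.deriv]
    exact hd
  have hconst : f =ᶠ[𝓝 y] fun _ => f y :=
    (hmax.and hmin).mono fun x hx => le_antisymm hx.1 hx.2
  have hzero : f' =ᶠ[𝓝 y] fun _ => 0 := by
    refine hderiv.symm.trans (hconst.deriv.trans ?_)
    simp
  have := hf'.unique ((hasDerivAt_const y (0 : ℝ)).congr_of_eventuallyEq hzero)
  exact hd.ne' this

theorem nonneg_of_hasDerivAt_of_le_left {f : ℝ → ℝ} {d a s : ℝ} (has : a < s)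
    (hf : HasDerivAt f d s) (hle : ∀ τ ∈ Set.Icc a s, f τ ≤ f s) : 0 ≤ d := by
  have h := hf.hasDerivWithinAt (s := Set.Iio s)
  rw [hasDerivWithinAt_iff_tendsto_slope' (by simp)] at h
  refine ge_of_tendsto h ?_
  filter_upwards [Ioo_mem_nhdsLT has] with τ hτ
  rw [slope_def_field]
  exact div_nonneg_of_nonpos (sub_nonpos.2 (hle τ ⟨hτ.1.le, hτ.2.le⟩)) (sub_nonpos.2 hτ.2.le)

/-- Weak maximum principle for classical subsolutions of the heat equation. -/
theorem le_of_heat_subsolution {L a b κ : ℝ} {w wt wx wxx : ℝ → ℝ → ℝ}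
    (hc : ContinuousOn (fun p : ℝ × ℝ => w p.1 p.2) (Set.Icc a b ×ˢ Set.Icc 0 L))
    (ht : ∀ t ∈ Set.Ioc a b, ∀ x ∈ Set.Ioo 0 L, HasDerivAt (fun τ => w τ x) (wt t x) t)
    (hx : ∀ t ∈ Set.Ioc a b, ∀ x ∈ Set.Ioo 0 L, HasDerivAt (w t) (wx t x) x)
    (hxx : ∀ t ∈ Set.Ioc a b, ∀ x ∈ Set.Ioo 0 L, HasDerivAt (wx t) (wxx t x) x)
    (pde : ∀ t ∈ Set.Ioc a b, ∀ x ∈ Set.Ioo 0 L, wt t x ≤ wxx t x)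
    (hinit : ∀ x ∈ Set.Icc 0 L, w a x ≤ κ)
    (hbc0 : ∀ t ∈ Set.Icc a b, w t 0 ≤ κ) (hbcL : ∀ t ∈ Set.Icc a b, w t L ≤ κ) :
    ∀ t ∈ Set.Icc a b, ∀ x ∈ Set.Icc 0 L, w t x ≤ κ := by
  intro t htm x hxm
  have key : ∀ γ > 0, w t x - γ * (t - a) ≤ κ := by
    intro γ hγ
    obtain ⟨⟨s, y⟩, ⟨hs, hy⟩, hmax⟩ :=
      (isCompact_Icc.prod isCompact_Icc).exists_isMaxOn ⟨(t, x), htm, hxm⟩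
        (f := fun p : ℝ × ℝ => w p.1 p.2 - γ * (p.1 - a)) (hc.sub (by fun_prop))
    simp only at hs hy
    rw [isMaxOn_iff] at hmax
    refine (hmax (t, x) ⟨htm, hxm⟩).trans ?_
    simp only
    have hnn : 0 ≤ γ * (s - a) := mul_nonneg hγ.le (sub_nonneg.2 hs.1)
    rcases eq_or_lt_of_le hs.1 with rfl | has
    · linarith [hinit y hy]
    rcases eq_or_lt_of_le hy.1 with rfl | hy0
    · linarith [hbc0 s hs]
    rcases eq_or_lt_of_le hy.2 with rfl | hyL
    · linarith [hbcL s hs]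
    exfalso
    have hs' : s ∈ Set.Ioc a b := ⟨has, hs.2⟩
    have htime : 0 ≤ wt s y - γ * 1 := by
      refine nonneg_of_hasDerivAt_of_le_left has
        ((ht s hs' y ⟨hy0, hyL⟩).sub (((hasDerivAt_id s).sub_const a).const_mul γ)) ?_
      intro τ hτ
      exact hmax (τ, y) ⟨⟨hτ.1, hτ.2.trans hs.2⟩, hy⟩
    have hspace : wxx s y ≤ 0 := by
      have hmem : Set.Ioo 0 L ∈ 𝓝 y := Ioo_mem_nhds hy0 hyL
      refine nonpos_of_isLocalMax_of_hasDerivAt (f := w s)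
        (Filter.mem_of_superset hmem fun z hz => hx s hs' z hz) (hxx s hs' y ⟨hy0, hyL⟩) ?_
      filter_upwards [hmem] with z hz
      have := hmax (s, z) ⟨hs, Set.Ioo_subset_Icc_self hz⟩
      simp only at this
      linarith
    linarith [pde s hs' y ⟨hy0, hyL⟩]
  refine le_of_forall_pos_le_add fun ε hε => ?_
  have hta : 0 ≤ t - a := sub_nonneg.2 htm.1
  have h := key (ε / (t - a + 1)) (by positivity)
  have : ε / (t - a + 1) * (t - a) ≤ ε := by
    rw [div_mul_eq_mul_div, div_le_iff₀ (by positivity)]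
    nlinarith
  linarith

theorem sin_mul_pow_cos_mem_span (m : ℕ) :
    (fun θ : ℝ => Real.sin θ * Real.cos θ ^ m) ∈
      Submodule.span ℝ (Set.range fun (k : ℕ) (θ : ℝ) => Real.sin (k * θ)) := by
  set S := Submodule.span ℝ (Set.range fun (k : ℕ) (θ : ℝ) => Real.sin (k * θ))
  have hstep : ∀ f ∈ S, (fun θ => f θ * Real.cos θ) ∈ S := by
    intro f hf
    induction hf using Submodule.span_induction with
    | mem f hf =>
      obtain ⟨k, rfl⟩ := hf
      rcases k with _ | k
      · simp only [Nat.cast_zero, zero_mul, Real.sin_zero]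
        exact S.zero_mem
      · have h1 : (fun θ : ℝ => Real.sin ((k + 2 : ℕ) * θ)) ∈ S := Submodule.subset_span ⟨k + 2, rfl⟩
        have h2 : (fun θ : ℝ => Real.sin ((k : ℕ) * θ)) ∈ S := Submodule.subset_span ⟨k, rfl⟩
        convert S.smul_mem (1 / 2 : ℝ) (S.add_mem h1 h2) using 1
        ext θ
        have e1 : ((k + 2 : ℕ) : ℝ) * θ = ((k + 1 : ℕ) : ℝ) * θ + θ := by push_cast; ring
        have e2 : (k : ℝ) * θ = ((k + 1 : ℕ) : ℝ) * θ - θ := by push_cast; ring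
        simp only [Pi.smul_apply, Pi.add_apply, smul_eq_mul]
        rw [e1, e2, Real.sin_add, Real.sin_sub]
        ring
    | zero =>
      simp only [Pi.zero_apply, zero_mul]
      exact S.zero_mem
    | add f g _ _ hf hg =>
      convert S.add_mem hf hg using 1
      ext θ
      simp [add_mul]
    | smul c f _ hf =>
      convert S.smul_mem c hf using 1
      ext θ
      simp [mul_assoc]
  induction m with
  | zero => exact Submodule.subset_span ⟨1, by ext; simp⟩
  | succ m ih =>
    convert hstep _ ih using 1
    ext θ
    rw [pow_succ, mul_assoc]

theorem sin_mul_eval_cos_mem_span (p : Polynomial ℝ) :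
    (fun θ : ℝ => Real.sin θ * p.eval (Real.cos θ)) ∈
      Submodule.span ℝ (Set.range fun (k : ℕ) (θ : ℝ) => Real.sin (k * θ)) := by
  have : (fun θ : ℝ => Real.sin θ * p.eval (Real.cos θ)) =
      ∑ i ∈ p.support, p.coeff i • fun θ : ℝ => Real.sin θ * Real.cos θ ^ i := by
    ext θ
    rw [Polynomial.eval_eq_sum, Polynomial.sum, Finset.mul_sum, Finset.sum_apply]
    refine Finset.sum_congr rfl fun i _ => ?_
    simp only [Pi.smul_apply, smul_eq_mul]
    ring
  rw [this]
  exact Submodule.sum_mem _ fun i _ => Submodule.smul_mem _ _ (sin_mul_pow_cos_mem_span i)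

/-- Finite sine sums are uniformly dense among continuous functions vanishing at both ends. -/
theorem exists_sine_sum_near {g : ℝ → ℝ} (hg : ContinuousOn g (Set.Icc 0 Real.pi))
    (hg0 : g 0 = 0) (hgπ : g Real.pi = 0) {η : ℝ} (hη : 0 < η) :
    ∃ c : ℕ →₀ ℝ, ∀ θ ∈ Set.Icc 0 Real.pi,
      |g θ - ∑ k ∈ c.support, c k * Real.sin (k * θ)| ≤ η := by
  have hη2 : 0 < η / 2 := by positivity
  obtain ⟨B, hB⟩ := isCompact_Icc.exists_bound_of_continuousOn hg
  obtain ⟨δ, hδ, hδg⟩ : ∃ δ > 0, ∀ θ ∈ Set.Icc 0 Real.pi,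
      |g θ| * δ ≤ η / 2 * (Real.sin θ ^ 2 + δ) := by
    have hK : IsCompact (Set.Icc 0 Real.pi ∩ (fun θ => |g θ|) ⁻¹' Set.Ici (η / 2)) :=
      isCompact_Icc.of_isClosed_subset
        (hg.abs.preimage_isClosed_of_isClosed isClosed_Icc isClosed_Ici) Set.inter_subset_left
    rcases Set.eq_empty_or_nonempty (Set.Icc 0 Real.pi ∩ (fun θ => |g θ|) ⁻¹' Set.Ici (η / 2))
      with hemp | hne
    · refine ⟨1, one_pos, fun θ hθ => ?_⟩
      have : |g θ| < η / 2 := by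
        by_contra! hcon
        exact Set.notMem_empty θ (hemp ▸ ⟨hθ, hcon⟩)
      nlinarith [mul_nonneg hη2.le (sq_nonneg (Real.sin θ))]
    · obtain ⟨θ₀, ⟨hθ₀, hgθ₀⟩, hmin⟩ := hK.exists_isMinOn hne
        (f := fun θ => Real.sin θ ^ 2) (by fun_prop)
      rw [isMinOn_iff] at hmin
      have hgne : g θ₀ ≠ 0 := by
        intro h
        simp only [Set.mem_preimage, Set.mem_Ici, h, abs_zero] at hgθ₀
        linarith
      have hsin : 0 < Real.sin θ₀ := by
        refine Real.sin_pos_of_pos_of_lt_pi (lt_of_le_of_ne hθ₀.1 ?_) (lt_of_le_of_ne hθ₀.2 ?_)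
        · rintro rfl; exact hgne hg0
        · rintro rfl; exact hgne hgπ
      have hBnn : 0 ≤ B := (norm_nonneg _).trans (hB θ₀ hθ₀)
      refine ⟨η / 2 * Real.sin θ₀ ^ 2 / (B + 1), by positivity, fun θ hθ => ?_⟩
      set δ := η / 2 * Real.sin θ₀ ^ 2 / (B + 1) with hδ
      have hδpos : 0 < δ := by positivity
      have hδB : (B + 1) * δ = η / 2 * Real.sin θ₀ ^ 2 := by rw [hδ]; field_simp
      by_cases hcase : η / 2 ≤ |g θ|
      · have h1 := hmin θ ⟨hθ, hcase⟩
        have h2 : |g θ| ≤ B := hB θ hθ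
        nlinarith [mul_le_mul_of_nonneg_right h2 hδpos.le]
      · push Not at hcase
        nlinarith [mul_nonneg hη2.le (sq_nonneg (Real.sin θ))]
  have hden : ∀ θ, 0 < Real.sin θ ^ 2 + δ := fun θ => by positivity
  obtain ⟨p, hp⟩ := exists_polynomial_near_of_continuousOn (-1) 1
    (fun u => (fun θ => g θ * Real.sin θ / (Real.sin θ ^ 2 + δ)) (Real.arccos u))
    (ContinuousOn.comp (t := Set.Icc 0 Real.pi)
      ((hg.mul (by fun_prop)).div (by fun_prop) fun θ _ => (hden θ).ne')
      Real.continuous_arccos.continuousOn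
      fun u _ => ⟨Real.arccos_nonneg u, Real.arccos_le_pi u⟩) (η / 2) hη2
  obtain ⟨c, hc⟩ := Finsupp.mem_span_range_iff_exists_finsupp.1 (sin_mul_eval_cos_mem_span p)
  refine ⟨c, fun θ hθ => ?_⟩
  have hsum : ∑ k ∈ c.support, c k * Real.sin (k * θ) = Real.sin θ * p.eval (Real.cos θ) := by
    have := congrFun hc θ
    simpa [Finsupp.sum, Finset.sum_apply] using this
  have h1 := hp (Real.cos θ) ⟨Real.neg_one_le_cos θ, Real.cos_le_one θ⟩
  simp only [Real.arccos_cos hθ.1 hθ.2] at h1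
  have h2 : |g θ - Real.sin θ * (g θ * Real.sin θ / (Real.sin θ ^ 2 + δ))| ≤ η / 2 := by
    have : g θ - Real.sin θ * (g θ * Real.sin θ / (Real.sin θ ^ 2 + δ)) =
        g θ * δ / (Real.sin θ ^ 2 + δ) := by
      have := (hden θ).ne'
      field_simp
      ring
    rw [this, abs_div, abs_mul, abs_of_pos hδ, abs_of_pos (hden θ), div_le_iff₀ (hden θ)]
    exact hδg θ hθ
  have h3 : |Real.sin θ * (g θ * Real.sin θ / (Real.sin θ ^ 2 + δ)) -
      Real.sin θ * p.eval (Real.cos θ)| ≤ η / 2 := by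
    rw [← mul_sub, abs_mul, abs_sub_comm]
    exact (mul_le_of_le_one_left (abs_nonneg _) (Real.abs_sin_le_one θ)).trans h1.le
  rw [hsum]
  calc _ ≤ _ := abs_sub_le _ (Real.sin θ * (g θ * Real.sin θ / (Real.sin θ ^ 2 + δ))) _
    _ ≤ η := by linarith

theorem integral_cos_int_mul {L : ℝ} (hL : 0 < L) {m : ℤ} (hm : m ≠ 0) :
    ∫ x in (0 : ℝ)..L, Real.cos (m * (Real.pi / L * x)) = 0 := by
  have hm' : (m : ℝ) ≠ 0 := by exact_mod_cast hm
  have hc : (m : ℝ) * (Real.pi / L) ≠ 0 := by positivity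
  have : ∀ x : ℝ, (m : ℝ) * (Real.pi / L * x) = m * (Real.pi / L) * x := fun x => by ring
  simp_rw [this]
  rw [intervalIntegral.integral_comp_mul_left _ hc, integral_cos]
  have h2 : (m : ℝ) * (Real.pi / L) * L = m * Real.pi := by field_simp
  simp [h2, Real.sin_int_mul_pi]

theorem integral_sin_mul_sin_of_ne {L : ℝ} (hL : 0 < L) {k j : ℕ} (hkj : k ≠ j) :
    ∫ x in (0 : ℝ)..L,
      Real.sin (k * (Real.pi / L * x)) * Real.sin (j * (Real.pi / L * x)) = 0 := by
  have h : ∀ x : ℝ, Real.sin (k * (Real.pi / L * x)) * Real.sin (j * (Real.pi / L * x)) =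
      (Real.cos (((k : ℤ) - j : ℤ) * (Real.pi / L * x)) -
        Real.cos (((k : ℤ) + j : ℤ) * (Real.pi / L * x))) / 2 := by
    intro x
    push_cast
    rw [sub_mul, add_mul, ← Real.two_mul_sin_mul_sin]
    ring
  simp_rw [h]
  rw [intervalIntegral.integral_div, intervalIntegral.integral_sub
    (Continuous.intervalIntegrable (by fun_prop) _ _)
    (Continuous.intervalIntegrable (by fun_prop) _ _),
    integral_cos_int_mul hL (by omega), integral_cos_int_mul hL (by omega)]
  simp

theorem integral_sine_sum_sq {L : ℝ} (hL : 0 < L) (s : Finset ℕ) (c : ℕ → ℝ) :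
    ∫ x in (0 : ℝ)..L, (∑ k ∈ s, c k * Real.sin (k * (Real.pi / L * x))) ^ 2 =
      ∑ k ∈ s, c k ^ 2 * ∫ x in (0 : ℝ)..L, Real.sin (k * (Real.pi / L * x)) ^ 2 := by
  have hexp : ∀ x : ℝ, (∑ k ∈ s, c k * Real.sin (k * (Real.pi / L * x))) ^ 2 =
      ∑ k ∈ s, ∑ j ∈ s, c k * c j *
        (Real.sin (k * (Real.pi / L * x)) * Real.sin (j * (Real.pi / L * x))) := by
    intro x
    rw [sq, Finset.sum_mul_sum]
    refine Finset.sum_congr rfl fun k _ => Finset.sum_congr rfl fun j _ => by ring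
  simp_rw [hexp]
  rw [intervalIntegral.integral_finsetSum
    fun k _ => Continuous.intervalIntegrable (by fun_prop) _ _]
  refine Finset.sum_congr rfl fun k hk => ?_
  rw [intervalIntegral.integral_finsetSum
    fun j _ => Continuous.intervalIntegrable (by fun_prop) _ _, Finset.sum_eq_single k]
  · rw [intervalIntegral.integral_const_mul]
    simp_rw [sq]
  · intro j _ hj
    rw [intervalIntegral.integral_const_mul, integral_sin_mul_sin_of_ne hL hj.symm, mul_zero]
  · exact fun h => absurd hk h

/-- The heat flow of a finite sine sum started at time `a`. -/
noncomputable def sineHeatFlow (L a : ℝ) (c : ℕ →₀ ℝ) (t x : ℝ) : ℝ :=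
  ∑ k ∈ c.support, c k * Real.exp (-(k * (Real.pi / L)) ^ 2 * (t - a)) *
    Real.sin (k * (Real.pi / L * x))

theorem continuous_sineHeatFlow (L a : ℝ) (c : ℕ →₀ ℝ) :
    Continuous fun p : ℝ × ℝ => sineHeatFlow L a c p.1 p.2 := by
  unfold sineHeatFlow
  fun_prop

theorem hasDerivAt_sineHeatFlow_time (L a : ℝ) (c : ℕ →₀ ℝ) (t x : ℝ) :
    HasDerivAt (fun τ => sineHeatFlow L a c τ x)
      (∑ k ∈ c.support, -(k * (Real.pi / L)) ^ 2 * c k *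
        Real.exp (-(k * (Real.pi / L)) ^ 2 * (t - a)) * Real.sin (k * (Real.pi / L * x))) t := by
  unfold sineHeatFlow
  refine HasDerivAt.fun_sum fun k _ => ?_
  have h := ((((hasDerivAt_id t).sub_const a).const_mul
    (-(k * (Real.pi / L)) ^ 2)).exp.const_mul (c k)).mul_const (Real.sin (k * (Real.pi / L * x)))
  refine h.congr_deriv ?_
  simp only [id]
  ring

theorem hasDerivAt_sineHeatFlow_space (L a : ℝ) (c : ℕ →₀ ℝ) (t x : ℝ) :
    HasDerivAt (sineHeatFlow L a c t)
      (∑ k ∈ c.support, k * (Real.pi / L) * c k *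
        Real.exp (-(k * (Real.pi / L)) ^ 2 * (t - a)) * Real.cos (k * (Real.pi / L * x))) x := by
  unfold sineHeatFlow
  refine HasDerivAt.fun_sum fun k _ => ?_
  have h := ((((hasDerivAt_id x).const_mul (Real.pi / L)).const_mul (k : ℝ)).sin).const_mul
    (c k * Real.exp (-(k * (Real.pi / L)) ^ 2 * (t - a)))
  refine h.congr_deriv ?_
  simp only [id]
  ring

theorem hasDerivAt_sineHeatFlow_space_space (L a : ℝ) (c : ℕ →₀ ℝ) (t x : ℝ) :
    HasDerivAt (fun ξ => ∑ k ∈ c.support, k * (Real.pi / L) * c k *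
        Real.exp (-(k * (Real.pi / L)) ^ 2 * (t - a)) * Real.cos (k * (Real.pi / L * ξ)))
      (∑ k ∈ c.support, -(k * (Real.pi / L)) ^ 2 * c k *
        Real.exp (-(k * (Real.pi / L)) ^ 2 * (t - a)) * Real.sin (k * (Real.pi / L * x))) x := by
  refine HasDerivAt.fun_sum fun k _ => ?_
  have h := ((((hasDerivAt_id x).const_mul (Real.pi / L)).const_mul (k : ℝ)).cos).const_mul
    (k * (Real.pi / L) * c k * Real.exp (-(k * (Real.pi / L)) ^ 2 * (t - a)))
  refine h.congr_deriv ?_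
  simp only [id]
  ring

theorem sineHeatFlow_left (L a : ℝ) (c : ℕ →₀ ℝ) (t : ℝ) : sineHeatFlow L a c t 0 = 0 := by
  simp [sineHeatFlow]

theorem sineHeatFlow_right {L : ℝ} (hL : 0 < L) (a : ℝ) (c : ℕ →₀ ℝ) (t : ℝ) :
    sineHeatFlow L a c t L = 0 := by
  refine Finset.sum_eq_zero fun k _ => ?_
  rw [div_mul_cancel₀ _ hL.ne', Real.sin_nat_mul_pi, mul_zero]

theorem integral_sineHeatFlow_sq_le {L : ℝ} (hL : 0 < L) {a b : ℝ} (hab : a ≤ b) (c : ℕ →₀ ℝ) :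
    ∫ x in (0 : ℝ)..L, sineHeatFlow L a c b x ^ 2 ≤
      ∫ x in (0 : ℝ)..L, sineHeatFlow L a c a x ^ 2 := by
  unfold sineHeatFlow
  rw [integral_sine_sum_sq hL, integral_sine_sum_sq hL]
  refine Finset.sum_le_sum fun k _ => mul_le_mul_of_nonneg_right ?_
    (intervalIntegral.integral_nonneg hL.le fun x _ => sq_nonneg _)
  rw [mul_pow (c k), mul_pow (c k)]
  refine mul_le_mul_of_nonneg_left ?_ (sq_nonneg (c k))
  refine pow_le_pow_left₀ (Real.exp_pos _).le (Real.exp_le_exp.2 ?_) 2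
  have : 0 ≤ (k * (Real.pi / L)) ^ 2 * (b - a) := mul_nonneg (sq_nonneg _) (sub_nonneg.2 hab)
  linarith

theorem integral_sq_le_of_abs_sub_le {L : ℝ} (hL : 0 < L) {f g : ℝ → ℝ} {B η : ℝ}
    (hf : ContinuousOn f (Set.Icc 0 L)) (hg : ContinuousOn g (Set.Icc 0 L))
    (hfB : ∀ x ∈ Set.Icc 0 L, |f x| ≤ B) (hgB : ∀ x ∈ Set.Icc 0 L, |g x| ≤ B)
    (hfg : ∀ x ∈ Set.Icc 0 L, |f x - g x| ≤ η) :
    ∫ x in (0 : ℝ)..L, f x ^ 2 ≤ (∫ x in (0 : ℝ)..L, g x ^ 2) + η * (2 * B) * L := by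
  rw [← Set.uIcc_of_le hL.le] at hf hg
  have h : ∫ x in (0 : ℝ)..L, f x ^ 2 ≤ ∫ x in (0 : ℝ)..L, (g x ^ 2 + η * (2 * B)) := by
    refine intervalIntegral.integral_mono_on hL.le (hf.pow 2).intervalIntegrable
      ((hg.pow 2).add continuousOn_const).intervalIntegrable fun x hx => ?_
    have h1 : f x ^ 2 - g x ^ 2 = (f x - g x) * (f x + g x) := by ring
    have h2 : |(f x - g x) * (f x + g x)| ≤ η * (2 * B) := by
      rw [abs_mul]
      refine mul_le_mul (hfg x hx) ((abs_add_le (f x) (g x)).trans ?_) (abs_nonneg _)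
        ((abs_nonneg (f x - g x)).trans (hfg x hx))
      linarith [hfB x hx, hgB x hx]
    linarith [le_abs_self ((f x - g x) * (f x + g x))]
  refine h.trans_eq ?_
  rw [intervalIntegral.integral_add (f := fun x => g x ^ 2) (hg.pow 2).intervalIntegrable (by simp)]
  simp only [intervalIntegral.integral_const, sub_zero, smul_eq_mul]
  ring

namespace IsDirichletHeatSol

variable {L : ℝ} {φ φt φx φxx : ℝ → ℝ → ℝ}

theorem continuousOn_space (h : IsDirichletHeatSol L φ φt φx φxx) {t : ℝ} (ht : 0 ≤ t) :
    ContinuousOn (φ t) (Set.Icc 0 L) :=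
  h.cont.comp (f := fun x => (t, x)) (by fun_prop) fun _ hx => ⟨ht, hx⟩

theorem abs_sub_sineHeatFlow_le (h : IsDirichletHeatSol L φ φt φx φxx) (hL : 0 < L)
    {a b : ℝ} (ha : 0 ≤ a) {c : ℕ →₀ ℝ} {η : ℝ} (hη : 0 ≤ η)
    (hinit : ∀ x ∈ Set.Icc 0 L, |φ a x - sineHeatFlow L a c a x| ≤ η) :
    ∀ t ∈ Set.Icc a b, ∀ x ∈ Set.Icc 0 L, |φ t x - sineHeatFlow L a c t x| ≤ η := by
  have hcont : ContinuousOn (fun p : ℝ × ℝ => φ p.1 p.2) (Set.Icc a b ×ˢ Set.Icc 0 L) :=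
    h.cont.mono (Set.prod_mono (fun t ht => ha.trans ht.1) subset_rfl)
  have hcu := (continuous_sineHeatFlow L a c).continuousOn (s := Set.Icc a b ×ˢ Set.Icc 0 L)
  have hpos : ∀ t ∈ Set.Ioc a b, 0 < t := fun t ht => ha.trans_lt ht.1
  have hφt : ∀ t ∈ Set.Ioc a b, ∀ x ∈ Set.Ioo 0 L,
      HasDerivAt (fun τ => φ τ x) (φt t x) t := fun t ht x hx =>
    h.ht t (hpos t ht) x (Set.Ioo_subset_Icc_self hx)
  have hφx : ∀ t ∈ Set.Ioc a b, ∀ x ∈ Set.Ioo 0 L, HasDerivAt (φ t) (φx t x) x :=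
    fun t ht x hx => (h.hx t (hpos t ht) x (Set.Ioo_subset_Icc_self hx)).hasDerivAt
      (Icc_mem_nhds hx.1 hx.2)
  have hφxx : ∀ t ∈ Set.Ioc a b, ∀ x ∈ Set.Ioo 0 L, HasDerivAt (φx t) (φxx t x) x :=
    fun t ht x hx => (h.hxx t (hpos t ht) x (Set.Ioo_subset_Icc_self hx)).hasDerivAt
      (Icc_mem_nhds hx.1 hx.2)
  have hnn : ∀ t ∈ Set.Icc a b, 0 ≤ t := fun t ht => ha.trans ht.1
  have hupper := le_of_heat_subsolution (κ := η) (hcont.sub hcu)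
    (fun t ht x hx => (hφt t ht x hx).sub (hasDerivAt_sineHeatFlow_time L a c t x))
    (fun t ht x hx => (hφx t ht x hx).sub (hasDerivAt_sineHeatFlow_space L a c t x))
    (fun t ht x hx => (hφxx t ht x hx).sub (hasDerivAt_sineHeatFlow_space_space L a c t x))
    (fun t ht x hx => by rw [h.pde t (hpos t ht) x hx])
    (fun x hx => (abs_le.1 (hinit x hx)).2)
    (fun t ht => by simpa [h.bc0 t (hnn t ht), sineHeatFlow_left] using hη)
    (fun t ht => by simpa [h.bcL t (hnn t ht), sineHeatFlow_right hL] using hη)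
  have hlower := le_of_heat_subsolution (κ := η) (hcu.sub hcont)
    (fun t ht x hx => (hasDerivAt_sineHeatFlow_time L a c t x).sub (hφt t ht x hx))
    (fun t ht x hx => (hasDerivAt_sineHeatFlow_space L a c t x).sub (hφx t ht x hx))
    (fun t ht x hx => (hasDerivAt_sineHeatFlow_space_space L a c t x).sub (hφxx t ht x hx))
    (fun t ht x hx => by rw [h.pde t (hpos t ht) x hx])
    (fun x hx => by
      have := (abs_le.1 (hinit x hx)).1
      simp only [Pi.sub_apply]
      linarith)
    (fun t ht => by simpa [h.bc0 t (hnn t ht), sineHeatFlow_left] using hη)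
    (fun t ht => by simpa [h.bcL t (hnn t ht), sineHeatFlow_right hL] using hη)
  intro t ht x hx
  have h1 := hupper t ht x hx
  have h2 := hlower t ht x hx
  simp only [Pi.sub_apply] at h1 h2
  exact abs_le.2 ⟨by linarith, h1⟩

/-- The `L²` norm of a Dirichlet heat solution is nonincreasing in time. -/
theorem integral_sq_le (h : IsDirichletHeatSol L φ φt φx φxx) (hL : 0 < L)
    {a b : ℝ} (ha : 0 ≤ a) (hab : a ≤ b) :
    ∫ x in (0 : ℝ)..L, φ b x ^ 2 ≤ ∫ x in (0 : ℝ)..L, φ a x ^ 2 := by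
  obtain ⟨B, hB⟩ := (isCompact_Icc.prod isCompact_Icc).exists_bound_of_continuousOn
    (h.cont.mono (Set.prod_mono (fun t (ht : t ∈ Set.Icc a b) => ha.trans ht.1) subset_rfl))
  have hBnn : 0 ≤ B :=
    (norm_nonneg _).trans (hB (a, 0) ⟨⟨le_rfl, hab⟩, ⟨le_rfl, hL.le⟩⟩)
  have key : ∀ η > 0, ∫ x in (0 : ℝ)..L, φ b x ^ 2 ≤
      (∫ x in (0 : ℝ)..L, φ a x ^ 2) + 2 * (η * (2 * (B + η)) * L) := by
    intro η hη
    have hscale : ∀ θ ∈ Set.Icc 0 Real.pi, L / Real.pi * θ ∈ Set.Icc 0 L := fun θ hθ =>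
      ⟨mul_nonneg (by positivity) hθ.1, by
        rw [div_mul_eq_mul_div, div_le_iff₀ Real.pi_pos]
        exact mul_le_mul_of_nonneg_left hθ.2 hL.le⟩
    obtain ⟨c, hc⟩ := exists_sine_sum_near (g := fun θ => φ a (L / Real.pi * θ))
      ((h.continuousOn_space ha).comp (by fun_prop) hscale)
      (by simp [h.bc0 a ha])
      (by simp only [div_mul_cancel₀ _ Real.pi_ne_zero, h.bcL a ha]) hη
    have hinit : ∀ x ∈ Set.Icc 0 L, |φ a x - sineHeatFlow L a c a x| ≤ η := by
      intro x hx
      have hx' := hc (Real.pi / L * x) ⟨mul_nonneg (by positivity) hx.1, by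
        rw [div_mul_eq_mul_div, div_le_iff₀ hL]
        exact mul_le_mul_of_nonneg_left hx.2 Real.pi_pos.le⟩
      have hxe : L / Real.pi * (Real.pi / L * x) = x := by field_simp
      simpa [sineHeatFlow, hxe] using hx'
    have hclose := h.abs_sub_sineHeatFlow_le hL (b := b) ha hη.le hinit
    have hφB : ∀ t ∈ Set.Icc a b, ∀ x ∈ Set.Icc 0 L, |φ t x| ≤ B + η := fun t ht x hx =>
      (hB (t, x) ⟨ht, hx⟩).trans (by linarith)
    have huB : ∀ t ∈ Set.Icc a b, ∀ x ∈ Set.Icc 0 L, |sineHeatFlow L a c t x| ≤ B + η := by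
      intro t ht x hx
      have h1 := abs_sub_abs_le_abs_sub (sineHeatFlow L a c t x) (φ t x)
      rw [abs_sub_comm] at h1
      have h2 : |φ t x| ≤ B := hB (t, x) ⟨ht, hx⟩
      linarith [hclose t ht x hx]
    have hu : ∀ t, ContinuousOn (sineHeatFlow L a c t) (Set.Icc 0 L) := fun t =>
      ((continuous_sineHeatFlow L a c).comp (Continuous.prodMk_right t)).continuousOn
    have hb : b ∈ Set.Icc a b := ⟨hab, le_rfl⟩
    have ha' : a ∈ Set.Icc a b := ⟨le_rfl, hab⟩
    have h1 := integral_sq_le_of_abs_sub_le hL (h.continuousOn_space (ha.trans hab)) (hu b)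
      (hφB b hb) (huB b hb) (hclose b hb)
    have h2 := integral_sq_le_of_abs_sub_le hL (hu a) (h.continuousOn_space ha)
      (huB a ha') (hφB a ha') fun x hx => by rw [abs_sub_comm]; exact hclose a ha' x hx
    linarith [integral_sineHeatFlow_sq_le hL hab c]
  have hlim : Filter.Tendsto
      (fun η => (∫ x in (0 : ℝ)..L, φ a x ^ 2) + 2 * (η * (2 * (B + η)) * L)) (𝓝[>] 0)
      (𝓝 ((∫ x in (0 : ℝ)..L, φ a x ^ 2) + 2 * (0 * (2 * (B + 0)) * L))) :=
    (Continuous.tendsto (by fun_prop) 0).mono_left nhdsWithin_le_nhds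
  have := ge_of_tendsto hlim (Filter.mem_of_superset self_mem_nhdsWithin key)
  simpa using this

end IsDirichletHeatSol

namespace IsAdjointTDSol

variable {L M ε : ℝ} {ψ ψt ψx ψxx : ℝ → ℝ → ℝ}

/-- Removing the drift and rescaling time turns an adjoint transport-diffusion solution into a
heat solution. -/
theorem isDirichletHeatSol (h : IsAdjointTDSol L M ε ψ ψt ψx ψxx) (hε : 0 < ε) :
    IsDirichletHeatSol L
      (fun t x => Real.exp (M ^ 2 * t / (4 * ε ^ 2) + M * x / (2 * ε)) * ψ (t / ε) x)
      (fun t x => Real.exp (M ^ 2 * t / (4 * ε ^ 2) + M * x / (2 * ε)) *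
        (M ^ 2 / (4 * ε ^ 2) * ψ (t / ε) x + ψt (t / ε) x / ε))
      (fun t x => Real.exp (M ^ 2 * t / (4 * ε ^ 2) + M * x / (2 * ε)) *
        (M / (2 * ε) * ψ (t / ε) x + ψx (t / ε) x))
      (fun t x => Real.exp (M ^ 2 * t / (4 * ε ^ 2) + M * x / (2 * ε)) *
        (M ^ 2 / (4 * ε ^ 2) * ψ (t / ε) x + M / ε * ψx (t / ε) x + ψxx (t / ε) x)) := by
  have hdiv : ∀ t > 0, t / ε > 0 := fun t ht => div_pos ht hε
  have hψx : ∀ t ≥ 0, ContinuousOn (ψ t) (Set.Icc 0 L) := fun t ht =>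
    h.cont.comp (f := fun x => (t, x)) (by fun_prop) fun _ hx => ⟨ht, hx⟩
  have hexpt : ∀ t x, HasDerivAt (fun t => Real.exp (M ^ 2 * t / (4 * ε ^ 2) + M * x / (2 * ε)))
      (Real.exp (M ^ 2 * t / (4 * ε ^ 2) + M * x / (2 * ε)) * (M ^ 2 * 1 / (4 * ε ^ 2))) t :=
    fun t x => ((((hasDerivAt_id t).const_mul (M ^ 2)).div_const (4 * ε ^ 2)).add_const _).exp
  have hexpx : ∀ t x, HasDerivAt (fun x => Real.exp (M ^ 2 * t / (4 * ε ^ 2) + M * x / (2 * ε)))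
      (Real.exp (M ^ 2 * t / (4 * ε ^ 2) + M * x / (2 * ε)) * (M * 1 / (2 * ε))) x :=
    fun t x => ((((hasDerivAt_id x).const_mul M).div_const (2 * ε)).const_add _).exp
  refine ⟨?_, ?_, ?_, ?_, ?_, ?_, ?_, ?_, ?_, ?_⟩
  · refine ContinuousOn.mul (by fun_prop) ?_
    exact h.cont.comp (f := fun p : ℝ × ℝ => (p.1 / ε, p.2)) (by fun_prop)
      fun p hp => ⟨div_nonneg hp.1 hε.le, hp.2⟩
  · intro t ht x hx
    have h1 := HasDerivAt.comp t (h.ht (t / ε) (hdiv t ht) x hx) ((hasDerivAt_id t).div_const ε)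
    refine ((hexpt t x).mul h1).congr_deriv ?_
    simp only [Function.comp_apply, id]
    ring
  · intro x hx
    have h1 : ContinuousOn (fun t => ψ (t / ε) x) (Set.Ioi 0) :=
      h.cont.comp (f := fun t => (t / ε, x)) (by fun_prop)
        fun t ht => ⟨(hdiv t ht).le, hx⟩
    have h2 : ContinuousOn (fun t => ψt (t / ε) x) (Set.Ioi 0) :=
      (h.htc x hx).comp (f := fun t => t / ε) (by fun_prop) hdiv
    exact ContinuousOn.mul (by fun_prop) ((h1.const_mul _).add (h2.div_const _))
  · intro t ht x hx
    refine ((hexpx t x).hasDerivWithinAt.mul (h.hx (t / ε) (hdiv t ht) x hx)).congr_deriv ?_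
    ring
  · intro t ht
    have h1 := hψx (t / ε) (hdiv t ht).le
    have h2 := h.hxc (t / ε) (hdiv t ht)
    fun_prop
  · intro t ht x hx
    refine ((hexpx t x).hasDerivWithinAt.mul
      (((h.hx (t / ε) (hdiv t ht) x hx).const_mul (M / (2 * ε))).add
        (h.hxx (t / ε) (hdiv t ht) x hx))).congr_deriv ?_
    simp only [Pi.add_apply]
    ring
  · intro t ht
    have h1 := hψx (t / ε) (hdiv t ht).le
    have h2 := h.hxc (t / ε) (hdiv t ht)
    have h3 := h.hxxc (t / ε) (hdiv t ht)
    fun_prop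
  · intro t ht x hx
    have h1 := h.pde (t / ε) (hdiv t ht) x hx
    have h2 : ψt (t / ε) x = ε * ψxx (t / ε) x + M * ψx (t / ε) x := by linarith
    simp only [h2]
    field_simp
    ring
  · intro t ht
    simp [h.bc0 (t / ε) (div_nonneg ht hε.le)]
  · intro t ht
    simp [h.bcL (t / ε) (div_nonneg ht hε.le)]

end IsAdjointTDSol

/-- Theorem 1 of the paper, case `M > 0`, `T > L/M`.  Assume
hypothesis (H) (Conjecture 2): for every `δ > 0` there are `C_δ, T_δ > 0` such that
every Dirichlet heat solution `φ` (with finite integrals) satisfies, for `S ∈ (0,T_δ)`,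
`∫_0^∞∫_0^L e^{-L²/(2t)} φ² ≤ C_δ e^{δ/S} ∫_0^S (∂_x φ(t,0))²`.  Then there exist
`C, K > 0`, independent of `ε`, such that for every `ε ∈ (0,1)` and every adjoint
transport-diffusion solution `ψ` (with all integrals finite)
`∫_0^L ψ(T,x)² dx ≤ C e^{-2K/ε} ∫_0^T (∂_x ψ(t,0))² dt`. -/
theorem uniform_controllability_pos_speed
    (L M T : ℝ) (hL : 0 < L) (hM : 0 < M) (hT : L / M < T)
    (H : ∀ δ > (0 : ℝ), ∃ Cδ > (0 : ℝ), ∃ Tδ > (0 : ℝ),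
      ∀ S ∈ Set.Ioo (0 : ℝ) Tδ, ∀ φ φt φx φxx : ℝ → ℝ → ℝ,
        IsDirichletHeatSol L φ φt φx φxx →
        IntegrableOn
          (fun t => ∫ x in (0 : ℝ)..L, Real.exp (-L ^ 2 / (2 * t)) * (φ t x) ^ 2)
          (Set.Ioi 0) →
        IntervalIntegrable (fun t => (φx t 0) ^ 2) volume 0 S →
        (∫ t in Set.Ioi (0 : ℝ),
            ∫ x in (0 : ℝ)..L, Real.exp (-L ^ 2 / (2 * t)) * (φ t x) ^ 2) ≤
          Cδ * Real.exp (δ / S) * ∫ t in (0 : ℝ)..S, (φx t 0) ^ 2) :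
    ∃ C > (0 : ℝ), ∃ K > (0 : ℝ), ∀ ε ∈ Set.Ioo (0 : ℝ) 1,
      ∀ ψ ψt ψx ψxx : ℝ → ℝ → ℝ,
        IsAdjointTDSol L M ε ψ ψt ψx ψxx →
        IntegrableOn
          (fun t => ∫ x in (0 : ℝ)..L, Real.exp (-L ^ 2 / (2 * t)) *
            (Real.exp (M ^ 2 * t / (4 * ε ^ 2) + M * x / (2 * ε)) * ψ (t / ε) x) ^ 2)
          (Set.Ioi 0) →
        (∀ S ∈ Set.Ioc (0 : ℝ) (ε * T), IntervalIntegrable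
          (fun t => (Real.exp (M ^ 2 * t / (4 * ε ^ 2)) * ψx (t / ε) 0) ^ 2)
          volume 0 S) →
        IntervalIntegrable (fun t => (ψx t 0) ^ 2) volume 0 T →
        (∫ x in (0 : ℝ)..L, (ψ T x) ^ 2) ≤
          C * Real.exp (-2 * K / ε) * ∫ t in (0 : ℝ)..T, (ψx t 0) ^ 2 := by
  have hLM : 0 < L / M := div_pos hL hM
  obtain ⟨T₁, hT₁, hT₁T⟩ := exists_between hT
  have hT₁0 : 0 < T₁ := hLM.trans hT₁
  have hT0 : 0 < T := hT₁0.trans hT₁T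
  obtain ⟨a, ha⟩ : ∃ a, a = (M ^ 2 * T - L ^ 2 / T₁) / 2 := ⟨_, rfl⟩
  have ha0 : 0 < a := by
    have hLT : L < T₁ * M := (div_lt_iff₀ hM).1 hT₁
    have h1 : L ^ 2 / T₁ < L * M := by
      rw [div_lt_iff₀ hT₁0]
      nlinarith
    nlinarith [mul_lt_mul_of_pos_right hT₁T hM]
  obtain ⟨s, hs0, hsT, hsa⟩ : ∃ s > 0, s ≤ T ∧ M ^ 2 * s / 2 ≤ a / 4 := by
    refine ⟨min T (a / (2 * M ^ 2)), by positivity, min_le_left _ _, ?_⟩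
    have : M ^ 2 * min T (a / (2 * M ^ 2)) ≤ M ^ 2 * (a / (2 * M ^ 2)) :=
      mul_le_mul_of_nonneg_left (min_le_right _ _) (sq_nonneg M)
    have h2 : M ^ 2 * (a / (2 * M ^ 2)) = a / 2 := by field_simp
    linarith
  have hδ : 0 < s * a / 4 := by positivity
  obtain ⟨Cδ, hCδ, Tδ, hTδ, hobs⟩ := H (s * a / 4) hδ
  have hTT : 0 < T - T₁ := sub_pos.2 hT₁T
  refine ⟨Cδ * Real.exp (s * a / 4 / (Tδ / 2)) / (T - T₁), by positivity, a / 4, by positivity, ?_⟩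
  intro ε ⟨hε, _⟩ ψ ψt ψx ψxx hψ hint₁ hint₂ hint₃
  have hφ := hψ.isDirichletHeatSol hε
  obtain ⟨S, hS⟩ : ∃ S, S = min (ε * s) (Tδ / 2) := ⟨_, rfl⟩
  have hS0 : 0 < S := by rw [hS]; positivity
  have hSs : S ≤ ε * s := by rw [hS]; exact min_le_left _ _
  have hSδ : S < Tδ := by rw [hS]; exact (min_le_right _ _).trans_lt (half_lt_self hTδ)
  have hST : S ≤ ε * T := hSs.trans (mul_le_mul_of_nonneg_left hsT hε.le)
  have hflux : ∀ t ≥ 0, Real.exp (M ^ 2 * t / (4 * ε ^ 2) + M * 0 / (2 * ε)) *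
      (M / (2 * ε) * ψ (t / ε) 0 + ψx (t / ε) 0) =
      Real.exp (M ^ 2 * t / (4 * ε ^ 2)) * ψx (t / ε) 0 := by
    intro t ht
    simp [hψ.bc0 (t / ε) (div_nonneg ht hε.le)]
  have hintS := hint₂ S ⟨hS0, hST⟩
  have hintS' : IntervalIntegrable
      (fun t => (Real.exp (M ^ 2 * t / (4 * ε ^ 2) + M * 0 / (2 * ε)) *
        (M / (2 * ε) * ψ (t / ε) 0 + ψx (t / ε) 0)) ^ 2) volume 0 S := by
    refine hintS.congr_uIoo fun t ht => ?_
    rw [Set.uIoo_of_le hS0.le] at ht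
    exact (congrArg (· ^ 2) (hflux t ht.1.le)).symm
  have hmain := hobs S ⟨hS0, hSδ⟩ _ _ _ _ hφ hint₁ hintS'
  have hupper : ∫ t in (0 : ℝ)..S, (Real.exp (M ^ 2 * t / (4 * ε ^ 2) + M * 0 / (2 * ε)) *
        (M / (2 * ε) * ψ (t / ε) 0 + ψx (t / ε) 0)) ^ 2 ≤
      Real.exp (a / 4 / ε) * (ε * ∫ t in (0 : ℝ)..T, ψx t 0 ^ 2) := by
    have hcomp : IntervalIntegrable (fun t => ψx (t / ε) 0 ^ 2) volume 0 S := by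
      have h1 := hint₃.comp_mul_right (c := ε⁻¹)
      simp only [div_inv_eq_mul, ← div_eq_mul_inv, zero_mul] at h1
      refine h1.mono_set ?_
      rw [Set.uIcc_of_le hS0.le, Set.uIcc_of_le (by positivity)]
      exact Set.Icc_subset_Icc_right (by linarith)
    calc _ ≤ ∫ t in (0 : ℝ)..S, Real.exp (a / 4 / ε) * ψx (t / ε) 0 ^ 2 := by
          refine intervalIntegral.integral_mono_on hS0.le hintS' (hcomp.const_mul _)
            fun t ht => ?_
          rw [hflux t ht.1, mul_pow, ← Real.exp_nat_mul]
          refine mul_le_mul_of_nonneg_right (Real.exp_le_exp.2 ?_) (sq_nonneg _)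
          have h1 : M ^ 2 * t ≤ M ^ 2 * (ε * s) :=
            mul_le_mul_of_nonneg_left (ht.2.trans hSs) (sq_nonneg M)
          rw [le_div_iff₀ hε]
          have h2 : ((2 : ℕ) : ℝ) * (M ^ 2 * t / (4 * ε ^ 2)) * ε = M ^ 2 * t / (2 * ε) := by
            push_cast
            field_simp
            ring
          rw [h2, div_le_iff₀ (by positivity)]
          nlinarith
      _ = Real.exp (a / 4 / ε) * (ε * ∫ t in (0 : ℝ)..S / ε, ψx t 0 ^ 2) := by
          rw [intervalIntegral.integral_const_mul,
            intervalIntegral.integral_comp_div (fun t => ψx t 0 ^ 2) hε.ne', zero_div, smul_eq_mul]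
      _ ≤ _ := by
          refine mul_le_mul_of_nonneg_left (mul_le_mul_of_nonneg_left ?_ hε.le) (Real.exp_pos _).le
          refine intervalIntegral.integral_mono_interval le_rfl (by positivity) ?_
            (Filter.Eventually.of_forall fun t => sq_nonneg _) hint₃
          rw [div_le_iff₀ hε]
          linarith
  have hcont : ∀ t ≥ 0, ContinuousOn (ψ t) (Set.uIcc 0 L) := fun t ht => by
    rw [Set.uIcc_of_le hL.le]
    exact hψ.cont.comp (f := fun x => (t, x)) (by fun_prop) fun _ hx => ⟨ht, hx⟩
  have hE : Real.exp (M ^ 2 * T / (2 * ε)) * ∫ x in (0 : ℝ)..L, ψ T x ^ 2 ≤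
      ∫ x in (0 : ℝ)..L, (Real.exp (M ^ 2 * (ε * T) / (4 * ε ^ 2) + M * x / (2 * ε)) *
        ψ (ε * T / ε) x) ^ 2 := by
    rw [← intervalIntegral.integral_const_mul, mul_div_cancel_left₀ T hε.ne']
    have hc := hcont T hT0.le
    refine intervalIntegral.integral_mono_on hL.le
      (ContinuousOn.intervalIntegrable (by fun_prop))
      (ContinuousOn.intervalIntegrable ((ContinuousOn.mul (by fun_prop) hc).pow 2))
      fun x hx => ?_
    rw [mul_pow, ← Real.exp_nat_mul]
    refine mul_le_mul_of_nonneg_right (Real.exp_le_exp.2 ?_) (sq_nonneg _)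
    have h1 : ((2 : ℕ) : ℝ) * (M ^ 2 * (ε * T) / (4 * ε ^ 2) + M * x / (2 * ε)) =
        M ^ 2 * T / (2 * ε) + M * x / ε := by
      push_cast
      field_simp
      ring
    rw [h1]
    have : 0 ≤ M * x / ε := div_nonneg (mul_nonneg hM.le hx.1) hε.le
    linarith
  have hlower : Real.exp (a / ε) * (∫ x in (0 : ℝ)..L, ψ T x ^ 2) * (ε * T - ε * T₁) ≤
      ∫ t in Set.Ioi (0 : ℝ), ∫ x in (0 : ℝ)..L, Real.exp (-L ^ 2 / (2 * t)) *
        (Real.exp (M ^ 2 * t / (4 * ε ^ 2) + M * x / (2 * ε)) * ψ (t / ε) x) ^ 2 := by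
    have hsub : Set.Ioc (ε * T₁) (ε * T) ⊆ Set.Ioi 0 := fun t ht =>
      (mul_pos hε hT₁0).trans ht.1
    rw [← Real.volume_real_Ioc_of_le (mul_le_mul_of_nonneg_left hT₁T.le hε.le)]
    refine (setIntegral_ge_of_const_le_real measurableSet_Ioc (by simp) ?_
      (hint₁.mono_set hsub)).trans (setIntegral_mono_set hint₁
        (Filter.Eventually.of_forall fun t => intervalIntegral.integral_nonneg hL.le
          fun x _ => by positivity) hsub.eventuallyLE)
    intro t ht
    have ht0 : 0 < t := hsub ht
    rw [intervalIntegral.integral_const_mul]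
    calc Real.exp (a / ε) * ∫ x in (0 : ℝ)..L, ψ T x ^ 2
        = Real.exp (-L ^ 2 / (2 * (ε * T₁))) *
            (Real.exp (M ^ 2 * T / (2 * ε)) * ∫ x in (0 : ℝ)..L, ψ T x ^ 2) := by
          rw [← mul_assoc, ← Real.exp_add, ha]
          congr 2
          field_simp
          ring
      _ ≤ _ := by
          refine mul_le_mul (Real.exp_le_exp.2 ?_)
            (hE.trans (hφ.integral_sq_le hL ht0.le ht.2)) (mul_nonneg (Real.exp_pos _).le
              (intervalIntegral.integral_nonneg hL.le fun x _ => sq_nonneg _)) (Real.exp_pos _).le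
          rw [neg_div, neg_div, neg_le_neg_iff]
          exact div_le_div_of_nonneg_left (sq_nonneg L) (by positivity) (by linarith [ht.1])
  have hexpS : Real.exp (s * a / 4 / S) ≤
      Real.exp (s * a / 4 / (Tδ / 2)) * Real.exp (a / 4 / ε) := by
    rw [← Real.exp_add]
    refine Real.exp_le_exp.2 ?_
    have h1 : s * a / 4 / (ε * s) = a / 4 / ε := by field_simp
    have h2 : 0 < s * a / 4 / (Tδ / 2) := by positivity
    have h3 : 0 < a / 4 / ε := by positivity
    rw [hS]
    rcases min_choice (ε * s) (Tδ / 2) with h | h <;> rw [h]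
    · linarith
    · linarith
  set E := ∫ x in (0 : ℝ)..L, ψ T x ^ 2
  set J := ∫ t in (0 : ℝ)..T, ψx t 0 ^ 2
  have hJ : 0 ≤ J := intervalIntegral.integral_nonneg hT0.le fun t _ => sq_nonneg _
  have hchain : Real.exp (a / ε) * E * (ε * T - ε * T₁) ≤
      Cδ * (Real.exp (s * a / 4 / (Tδ / 2)) * Real.exp (a / 4 / ε)) *
        (Real.exp (a / 4 / ε) * (ε * J)) := by
    refine (hlower.trans hmain).trans ?_
    refine mul_le_mul (mul_le_mul_of_nonneg_left hexpS hCδ.le) hupper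
      (intervalIntegral.integral_nonneg hS0.le fun t _ => sq_nonneg _) (by positivity)
  have hexp : Real.exp (a / ε) * Real.exp (-2 * (a / 4) / ε) =
      Real.exp (a / 4 / ε) * Real.exp (a / 4 / ε) := by
    rw [← Real.exp_add, ← Real.exp_add]
    congr 1
    ring
  refine le_of_mul_le_mul_left ?_ (show 0 < Real.exp (a / ε) * (ε * (T - T₁)) by positivity)
  calc Real.exp (a / ε) * (ε * (T - T₁)) * E = Real.exp (a / ε) * E * (ε * T - ε * T₁) := by ring
    _ ≤ _ := hchain
    _ = Real.exp (a / 4 / ε) * Real.exp (a / 4 / ε) *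
        (Cδ * Real.exp (s * a / 4 / (Tδ / 2)) * (ε * J)) := by ring
    _ = _ := by
      rw [← hexp]
      field_simp
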